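/- arXiv:2205.11331 — 3 statements merged into one kernel-verified Lean document; each statement's English description precedes it below -/
import Mathlib

section
/- For every integer m ≥ 1 and every real a ≥ 0, the function b ↦ log Q_m(√a, √b) is differentiable at every b > 0, with derivative (1/2) · Q_{m−1}(√a, √b) / Q_m(√a, √b) − 1/2. -/
/-- Integer-order generalized Marcum Q-function in squared arguments:
`marcumQ m a b = Q_m(√a, √b)`. -/
noncomputable def marcumQ (m : ℕ) (a b : ℝ) : ℝ :=
  Real.exp (-(a + b) / 2) *
    ∑' n : ℕ, ((a / 2) ^ n / (Nat.factorial n : ℝ)) *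
      ∑ k ∈ Finset.range (n + m), (b / 2) ^ k / (Nat.factorial k : ℝ)

theorem marcum_partial_deriv (N : ℕ) (x : ℝ) :
    HasDerivAt (fun y : ℝ => ∑ k ∈ Finset.range (N + 1), (y / 2) ^ k / (Nat.factorial k : ℝ))
      (1 / 2 * ∑ k ∈ Finset.range N, (x / 2) ^ k / (Nat.factorial k : ℝ)) x := by
  induction N with
  | zero => simpa using hasDerivAt_const x (1 : ℝ)
  | succ N ih =>
    have h1 : HasDerivAt (fun y : ℝ => (y / 2) ^ (N + 1) / (Nat.factorial (N + 1) : ℝ))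
        (1 / 2 * ((x / 2) ^ N / (Nat.factorial N : ℝ))) x := by
      have h := ((((hasDerivAt_id x).div_const 2).pow (N + 1)).div_const
        (Nat.factorial (N + 1) : ℝ))
      refine h.congr_deriv ?_
      have h0 : (Nat.factorial N : ℝ) ≠ 0 := by positivity
      have h2 : ((N : ℝ) + 1) ≠ 0 := by positivity
      simp only [Nat.factorial_succ, id]
      push_cast
      field_simp
    have h2 := ih.add h1
    rw [Finset.sum_range_succ, mul_add]
    refine h2.congr_of_eventuallyEq (Filter.Eventually.of_forall fun y => ?_)
    simp only [Pi.add_apply]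
    rw [Finset.sum_range_succ]

theorem marcum_summable (m : ℕ) (a : ℝ) (ha : 0 ≤ a) (b : ℝ) (hb : 0 ≤ b) :
    Summable (fun n : ℕ => ((a / 2) ^ n / (Nat.factorial n : ℝ)) *
      ∑ k ∈ Finset.range (n + m), (b / 2) ^ k / (Nat.factorial k : ℝ)) := by
  refine Summable.of_nonneg_of_le (fun n => by positivity) (fun n => ?_)
    ((Real.summable_pow_div_factorial (a / 2)).mul_right (Real.exp (b / 2)))
  exact mul_le_mul_of_nonneg_left (Real.sum_le_exp_of_nonneg (by positivity) _) (by positivity)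

theorem marcum_tsum_deriv (p : ℕ) (a : ℝ) (ha : 0 ≤ a) (b : ℝ) (hb : 0 < b) :
    HasDerivAt (fun x : ℝ => ∑' n : ℕ, ((a / 2) ^ n / (Nat.factorial n : ℝ)) *
      ∑ k ∈ Finset.range (n + (p + 1)), (x / 2) ^ k / (Nat.factorial k : ℝ))
      (1 / 2 * ∑' n : ℕ, ((a / 2) ^ n / (Nat.factorial n : ℝ)) *
      ∑ k ∈ Finset.range (n + p), (b / 2) ^ k / (Nat.factorial k : ℝ)) b := by
  have hu : Summable (fun n : ℕ => (a / 2) ^ n / (Nat.factorial n : ℝ) *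
      (1 / 2 * Real.exp ((b + 1) / 2))) :=
    (Real.summable_pow_div_factorial (a / 2)).mul_right _
  have hmem : b ∈ Set.Ioo 0 (b + 1) := ⟨hb, by linarith⟩
  have h := hasDerivAt_tsum_of_isPreconnected (t := Set.Ioo 0 (b + 1)) (y₀ := b) (y := b)
    (g := fun (n : ℕ) (x : ℝ) => ((a / 2) ^ n / (Nat.factorial n : ℝ)) *
      ∑ k ∈ Finset.range (n + (p + 1)), (x / 2) ^ k / (Nat.factorial k : ℝ))
    (g' := fun (n : ℕ) (x : ℝ) => ((a / 2) ^ n / (Nat.factorial n : ℝ)) *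
      (1 / 2 * ∑ k ∈ Finset.range (n + p), (x / 2) ^ k / (Nat.factorial k : ℝ)))
    hu isOpen_Ioo isPreconnected_Ioo
    (fun n x _ => (marcum_partial_deriv (n + p) x).const_mul _)
    (fun n x hx => by
      have hx0 : 0 ≤ x := hx.1.le
      rw [Real.norm_of_nonneg (by positivity)]
      have h1 : ∑ k ∈ Finset.range (n + p), (x / 2) ^ k / (Nat.factorial k : ℝ)
          ≤ Real.exp ((b + 1) / 2) :=
        (Real.sum_le_exp_of_nonneg (by positivity) _).trans
          (Real.exp_le_exp.2 (by linarith [hx.2]))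
      gcongr)
    hmem (marcum_summable (p + 1) a ha b hb.le) hmem
  refine h.congr_deriv ?_
  rw [← tsum_mul_left]
  exact tsum_congr fun n => by ring

theorem marcumQ_pos (p : ℕ) (a : ℝ) (ha : 0 ≤ a) (b : ℝ) (hb : 0 < b) :
    0 < marcumQ (p + 1) a b := by
  unfold marcumQ
  refine mul_pos (Real.exp_pos _) ?_
  refine (marcum_summable (p + 1) a ha b hb.le).tsum_pos (fun n => by positivity) 0 ?_
  have : 0 < ∑ k ∈ Finset.range (0 + (p + 1)), (b / 2) ^ k / (Nat.factorial k : ℝ) :=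
    Finset.sum_pos (fun k _ => by positivity) (by simp)
  simpa using this

theorem stmt2 (m : ℕ) (hm : 1 ≤ m) (a : ℝ) (ha : 0 ≤ a) (b : ℝ) (hb : 0 < b) :
    HasDerivAt (fun x : ℝ => Real.log (marcumQ m a x))
      (1 / 2 * (marcumQ (m - 1) a b / marcumQ m a b) - 1 / 2) b := by
  obtain ⟨p, rfl⟩ : ∃ p, m = p + 1 := ⟨m - 1, by omega⟩
  have hpos := marcumQ_pos p a ha b hb
  have he : HasDerivAt (fun x : ℝ => Real.exp (-(a + x) / 2))
      (Real.exp (-(a + b) / 2) * (-1 / 2)) b :=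
    ((((hasDerivAt_id b).const_add a).neg).div_const 2).exp
  have hQ : HasDerivAt (fun x : ℝ => marcumQ (p + 1) a x)
      (1 / 2 * marcumQ p a b - 1 / 2 * marcumQ (p + 1) a b) b := by
    have h := he.mul (marcum_tsum_deriv p a ha b hb)
    refine h.congr_deriv ?_
    unfold marcumQ
    ring
  refine (hQ.log hpos.ne').congr_deriv ?_
  rw [Nat.add_sub_cancel]
  field_simp
end

section
/- For every integer m ≥ 1 and all reals a ≥ 0, b > 0, Δ > 0, the increment of the log-Marcum-Q function in its first squared argument satisfies: log Q_m(√(a+Δ), √b) − log Q_m(√a, √b) ≥ ( (1/2) · Q_{m+1}(√(a+Δ), √b) / Q_m(√(a+Δ), √b) − 1/2 ) · Δ. -/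
noncomputable def mqT (y : ℝ) (k : ℕ) : ℝ := y ^ k / (Nat.factorial k : ℝ)
noncomputable def mqC (y : ℝ) (j : ℕ) : ℝ := ∑ k ∈ Finset.range j, mqT y k
noncomputable def mqF (y : ℝ) (m : ℕ) (x : ℝ) : ℝ := ∑' n : ℕ, mqT x n * mqC y (n + m)

lemma mqT_nonneg {y : ℝ} (hy : 0 ≤ y) (k : ℕ) : 0 ≤ mqT y k := by
  unfold mqT; positivity

lemma mqT_succ (y : ℝ) (k : ℕ) : ((k : ℝ) + 1) * mqT y (k + 1) = y * mqT y k := by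
  unfold mqT
  rw [Nat.factorial_succ]
  push_cast
  field_simp
  ring

lemma mqC_nonneg {y : ℝ} (hy : 0 ≤ y) (j : ℕ) : 0 ≤ mqC y j :=
  Finset.sum_nonneg fun k _ => mqT_nonneg hy k

lemma mqC_succ (y : ℝ) (j : ℕ) : mqC y (j + 1) = mqC y j + mqT y j := by
  unfold mqC; rw [Finset.sum_range_succ]

lemma mqC_le {y : ℝ} (hy : 0 ≤ y) (j : ℕ) : mqC y j ≤ Real.exp y :=
  Real.sum_le_exp_of_nonneg hy j

lemma mqC_step {y : ℝ} (hy : 0 ≤ y) (q : ℕ) : y * mqC y q ≤ ((q : ℝ) + 1) * mqC y (q + 1) := by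
  induction q with
  | zero => 
    have := mqC_nonneg hy 1
    simp [mqC] at this ⊢; exact this
  | succ q ih =>
    rw [mqC_succ y (q + 1)]
    have h1 := mqT_succ y q
    have h2 := mqC_nonneg hy (q + 1)
    have h3 := mqT_nonneg hy (q + 1)
    have h4 := mqC_succ y q
    have : y * mqC y (q + 1) = y * mqC y q + y * mqT y q := by rw [h4]; ring
    push_cast
    nlinarith

lemma mqC_T {y : ℝ} (hy : 0 ≤ y) (p q : ℕ) (h : p ≤ q) :
    mqC y p * mqT y q ≤ mqT y p * mqC y q := by
  induction q, h using Nat.le_induction with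
  | base => rw [mul_comm]
  | succ q hpq ih =>
    have h1 := mqT_succ y q
    have h2 := mqC_step hy q
    have hp := mqT_nonneg hy p
    have hq : (0 : ℝ) < (q : ℝ) + 1 := by positivity
    refine le_of_mul_le_mul_left ?_ hq
    calc ((q : ℝ) + 1) * (mqC y p * mqT y (q + 1)) = mqC y p * (((q : ℝ) + 1) * mqT y (q + 1)) := by ring
      _ = y * (mqC y p * mqT y q) := by rw [h1]; ring
      _ ≤ y * (mqT y p * mqC y q) := by gcongr
      _ = mqT y p * (y * mqC y q) := by ring
      _ ≤ mqT y p * (((q : ℝ) + 1) * mqC y (q + 1)) := by gcongr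
      _ = _ := by ring

noncomputable def mqW (y : ℝ) (p q : ℕ) : ℝ := mqC y p * mqC y (q + 1) - mqC y (p + 1) * mqC y q

lemma mqW_nonpos {y : ℝ} (hy : 0 ≤ y) (p q : ℕ) (h : p ≤ q) : mqW y p q ≤ 0 := by
  unfold mqW
  rw [mqC_succ, mqC_succ]
  have := mqC_T hy p q h
  nlinarith

noncomputable def mqE (y : ℝ) (N p q : ℕ) : ℝ :=
  ∑ ij ∈ Finset.HasAntidiagonal.antidiagonal N, (N.choose ij.1 : ℝ) * mqW y (ij.1 + p) (ij.2 + q)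

lemma mqE_succ (y : ℝ) (N p q : ℕ) : mqE y (N + 1) p q = mqE y N p (q + 1) + mqE y N (p + 1) q := by
  unfold mqE
  rw [Finset.sum_antidiagonal_choose_succ_mul (fun i j => mqW y (i + p) (j + q))]
  congr 1
  · refine Finset.sum_congr rfl fun ij _ => ?_
    congr 2; ring
  · refine Finset.sum_congr rfl fun ij h => ?_
    have : N.choose ij.2 = N.choose ij.1 := by
      rw [Finset.HasAntidiagonal.mem_antidiagonal] at h
      exact (Nat.choose_symm_of_eq_add h.symm).symm
    rw [this]
    congr 2; ring

lemma mqE_anti (y : ℝ) (N p q : ℕ) : mqE y N q p = - mqE y N p q := by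
  induction N generalizing p q with
  | zero => simp [mqE, mqW]; ring
  | succ N ih => rw [mqE_succ, mqE_succ, ih p (q+1), ih (p+1) q]; ring

lemma mqE_nonpos {y : ℝ} (hy : 0 ≤ y) (N p q : ℕ) (h : p ≤ q) : mqE y N p q ≤ 0 := by
  induction N generalizing p q with
  | zero => simpa [mqE] using mqW_nonpos hy p q h
  | succ N ih =>
    rw [mqE_succ]
    rcases h.eq_or_lt with rfl | h
    · rw [mqE_anti y N p (p + 1)]; simp
    · have := ih p (q + 1) (by omega)
      have := ih (p + 1) q (by omega)
      linarith

lemma mqF_summable_norm {y : ℝ} (hy : 0 ≤ y) (m : ℕ) (x : ℝ) :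
    Summable fun n => ‖mqT x n * mqC y (n + m)‖ := by
  refine Summable.of_nonneg_of_le (fun _ => norm_nonneg _) (fun n => ?_)
    ((Real.summable_pow_div_factorial |x|).mul_right (Real.exp y))
  rw [norm_mul, Real.norm_of_nonneg (mqC_nonneg hy _)]
  have : ‖mqT x n‖ = |x| ^ n / (Nat.factorial n : ℝ) := by
    unfold mqT; simp
  rw [this]
  gcongr
  exact mqC_le hy _

lemma mqF_logconc {y : ℝ} (hy : 0 ≤ y) (m : ℕ) {x : ℝ} (hx : 0 ≤ x) :
    mqF y m x * mqF y (m + 2) x ≤ mqF y (m + 1) x * mqF y (m + 1) x := by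
  have s := fun m => mqF_summable_norm hy m x
  unfold mqF
  rw [tsum_mul_tsum_eq_tsum_sum_antidiagonal_of_summable_norm (s m) (s (m+2)),
    tsum_mul_tsum_eq_tsum_sum_antidiagonal_of_summable_norm (s (m+1)) (s (m+1))]
  refine Summable.tsum_le_tsum (fun N => ?_)
    (summable_norm_sum_mul_antidiagonal_of_summable_norm (s m) (s (m+2))).of_norm
    (summable_norm_sum_mul_antidiagonal_of_summable_norm (s (m+1)) (s (m+1))).of_norm
  rw [← sub_nonpos, ← Finset.sum_sub_distrib]
  have h := mqE_nonpos hy N m (m + 1) (by omega)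
  have : ∑ ij ∈ Finset.HasAntidiagonal.antidiagonal N, (mqT x ij.1 * mqC y (ij.1 + m) * (mqT x ij.2 * mqC y (ij.2 + (m + 2))) -
      mqT x ij.1 * mqC y (ij.1 + (m + 1)) * (mqT x ij.2 * mqC y (ij.2 + (m + 1)))) = mqT x N * mqE y N m (m + 1) := by
    unfold mqE
    rw [Finset.mul_sum]
    refine Finset.sum_congr rfl fun ij hij => ?_
    rw [Finset.HasAntidiagonal.mem_antidiagonal] at hij
    have key : mqT x ij.1 * mqT x ij.2 = mqT x N * (N.choose ij.1 : ℝ) := by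
      subst hij
      unfold mqT
      rw [Nat.cast_add_choose, pow_add]
      field_simp
    rw [← mul_assoc (mqT x N), ← key]
    unfold mqW
    simp only [← add_assoc]
    ring_nf
  rw [this]
  exact mul_nonpos_of_nonneg_of_nonpos (mqT_nonneg hx N) h

lemma mqT_deriv (n : ℕ) (x : ℝ) : HasDerivAt (fun x => mqT x (n + 1)) (mqT x n) x := by
  unfold mqT
  have := (hasDerivAt_pow (n + 1) x).div_const ((Nat.factorial (n + 1) : ℝ))
  have e : ((n + 1 : ℕ) : ℝ) * x ^ (n + 1 - 1) / (Nat.factorial (n + 1) : ℝ) = x ^ n / (Nat.factorial n : ℝ) := by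
    rw [Nat.factorial_succ]
    push_cast
    field_simp
  rw [e] at this
  exact this

lemma mqF_succ {y : ℝ} (hy : 0 ≤ y) (m : ℕ) (x : ℝ) :
    mqF y m x = mqC y m + ∑' n : ℕ, mqT x (n + 1) * mqC y (n + (m + 1)) := by
  unfold mqF
  rw [(mqF_summable_norm hy m x).of_norm.tsum_eq_zero_add]
  congr 1
  · simp [mqT]
  · refine tsum_congr fun n => ?_
    congr 2; ring

lemma mqF_deriv {y : ℝ} (hy : 0 ≤ y) (m : ℕ) (x : ℝ) :
    HasDerivAt (mqF y m) (mqF y (m + 1) x) x := by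
  have e : mqF y m = fun x => mqC y m + ∑' n : ℕ, mqT x (n + 1) * mqC y (n + (m + 1)) :=
    funext (mqF_succ hy m)
  rw [e]
  refine HasDerivAt.const_add _ ?_
  have hx : x ∈ Metric.ball (0 : ℝ) (|x| + 1) := by simp
  refine hasDerivAt_tsum_of_isPreconnected (t := Metric.ball (0 : ℝ) (|x| + 1))
    (g := fun n x => mqT x (n + 1) * mqC y (n + (m + 1)))
    (g' := fun n x => mqT x n * mqC y (n + (m + 1)))
    ((Real.summable_pow_div_factorial (|x| + 1)).mul_right (Real.exp y))
    Metric.isOpen_ball (convex_ball _ _).isPreconnected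
    (fun n z _ => (mqT_deriv n z).mul_const _) (fun n z hz => ?_) hx ?_ hx
  · rw [norm_mul, Real.norm_of_nonneg (mqC_nonneg hy _)]
    have : ‖mqT z n‖ = |z| ^ n / (Nat.factorial n : ℝ) := by
      unfold mqT; simp
    rw [this]
    have hz' : |z| ≤ |x| + 1 := by
      rw [mem_ball_zero_iff, Real.norm_eq_abs] at hz
      exact hz.le
    gcongr
    · exact mqC_nonneg hy _
    · exact mqC_le hy _
  · have := (summable_nat_add_iff 1).2 (mqF_summable_norm hy m x).of_norm
    refine this.congr fun n => ?_
    congr 2; ring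

lemma mqF_pos {y : ℝ} (hy : 0 ≤ y) (m : ℕ) (hm : 1 ≤ m) {x : ℝ} (hx : 0 ≤ x) : 0 < mqF y m x := by
  refine (mqF_summable_norm hy m x).of_norm.tsum_pos
    (fun n => mul_nonneg (mqT_nonneg hx n) (mqC_nonneg hy _)) 0 ?_
  obtain ⟨k, rfl⟩ := Nat.exists_eq_add_of_le' hm
  have h : 0 < mqC y (0 + (k + 1)) := by
    refine Finset.sum_pos' (fun k _ => mqT_nonneg hy k) ⟨0, by simp, by simp [mqT]⟩
  have : mqT x 0 = 1 := by simp [mqT]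
  rw [this, one_mul]; exact h

lemma mqF_main {y : ℝ} (hy : 0 ≤ y) (m : ℕ) (hm : 1 ≤ m) {x z : ℝ} (hx : 0 ≤ x) (hxz : x < z) :
    mqF y (m + 1) z / mqF y m z * (z - x) ≤ Real.log (mqF y m z) - Real.log (mqF y m x) := by
  have hd : ∀ w, 0 ≤ w → HasDerivAt (fun w => Real.log (mqF y m w)) (mqF y (m + 1) w / mqF y m w) w :=
    fun w hw => (mqF_deriv hy m w).log (mqF_pos hy m hm hw).ne'
  have hr : ∀ w, 0 ≤ w → HasDerivAt (fun w => mqF y (m + 1) w / mqF y m w)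
      ((mqF y (m + 2) w * mqF y m w - mqF y (m + 1) w * mqF y (m + 1) w) / mqF y m w ^ 2) w :=
    fun w hw => (mqF_deriv hy (m + 1) w).div (mqF_deriv hy m w) (mqF_pos hy m hm hw).ne'
  have anti : AntitoneOn (fun w => mqF y (m + 1) w / mqF y m w) (Set.Ici 0) := by
    refine antitoneOn_of_deriv_nonpos (convex_Ici 0)
      (fun w hw => (hr w hw).continuousAt.continuousWithinAt)
      (fun w hw => (hr w (interior_subset hw)).differentiableAt.differentiableWithinAt)
      (fun w hw => ?_)
    have hw' : 0 ≤ w := interior_subset hw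
    rw [(hr w hw').deriv]
    have := mqF_logconc hy m hw'
    exact div_nonpos_of_nonpos_of_nonneg (by linarith) (sq_nonneg _)
  obtain ⟨c, hc, h⟩ := exists_hasDerivAt_eq_slope (fun w => Real.log (mqF y m w))
    (fun w => mqF y (m + 1) w / mqF y m w) hxz
    (fun w hw => (hd w (hx.trans hw.1)).continuousAt.continuousWithinAt)
    (fun w hw => hd w (hx.trans hw.1.le))
  have h1 := anti (show (0:ℝ) ≤ c from hx.trans hc.1.le) (show (0:ℝ) ≤ z from hx.trans hxz.le) hc.2.le
  simp only at h1
  rw [h] at h1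
  rwa [le_div_iff₀ (sub_pos.2 hxz)] at h1

lemma marcumQ_eq (m : ℕ) (a b : ℝ) :
    marcumQ m a b = Real.exp (-(a + b) / 2) * mqF (b / 2) m (a / 2) := rfl

theorem stmt4 (m : ℕ) (hm : 1 ≤ m) (a : ℝ) (ha : 0 ≤ a) (b : ℝ) (hb : 0 < b)
    (Δ : ℝ) (hΔ : 0 < Δ) :
    Real.log (marcumQ m (a + Δ) b) - Real.log (marcumQ m a b) ≥
      (1 / 2 * (marcumQ (m + 1) (a + Δ) b / marcumQ m (a + Δ) b) - 1 / 2) * Δ := by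
  have hy : 0 ≤ b / 2 := by positivity
  have h := mqF_main hy m hm (x := a / 2) (z := (a + Δ) / 2) (by positivity) (by linarith)
  simp only [marcumQ_eq]
  rw [mul_div_mul_left _ _ (Real.exp_pos _).ne',
    Real.log_mul (Real.exp_pos _).ne' (mqF_pos hy m hm (by positivity)).ne',
    Real.log_mul (Real.exp_pos _).ne' (mqF_pos hy m hm (by positivity)).ne',
    Real.log_exp, Real.log_exp]
  linarith
end

section
/- Let V be an N×P complex matrix such that Vᴴ V is invertible, let σ > 0 be real, and let a ∈ ℂᴺ. Then for every t ≥ 0 the matrix t·V Vᴴ + σ² I is invertible, and as t → ∞ the quadratic form aᴴ (t·V Vᴴ + σ² I)⁻¹ a converges to σ⁻² · aᴴ (I − V (Vᴴ V)⁻¹ Vᴴ) a = σ⁻² · ‖(I − V (Vᴴ V)⁻¹ Vᴴ) a‖². -/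
open Matrix Filter ComplexOrder in
theorem aux_unit {m n : ℕ} (W : Matrix (Fin m) (Fin n) ℂ) (t s : ℝ) (ht : 0 ≤ t) (hs : 0 < s) :
    IsUnit ((t : ℂ) • (W * Wᴴ) + (s : ℂ) • (1 : Matrix (Fin m) (Fin m) ℂ)) := by
  apply Matrix.PosDef.isUnit
  apply Matrix.PosDef.posSemidef_add
  · exact (Matrix.posSemidef_self_mul_conjTranspose W).smul (by exact_mod_cast ht)
  · exact Matrix.PosDef.one.smul (by exact_mod_cast hs)

open Matrix Filter in
theorem aux_cont {n : ℕ} (G : Matrix (Fin n) (Fin n) ℂ) (hG : IsUnit G) :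
    ContinuousAt (fun A : Matrix (Fin n) (Fin n) ℂ => A⁻¹) G := by
  have hd : G.det ≠ 0 := by
    rw [Matrix.isUnit_iff_isUnit_det] at hG
    exact hG.ne_zero
  simp only [Matrix.inv_def, Ring.inverse_eq_inv']
  have h1 : Continuous (fun A : Matrix (Fin n) (Fin n) ℂ => A.det) := continuous_id.matrix_det
  have h2 : Continuous (fun A : Matrix (Fin n) (Fin n) ℂ => A.adjugate) :=
    continuous_id.matrix_adjugate
  exact (h1.continuousAt.inv₀ hd).smul h2.continuousAt

open Matrix Filter in
theorem aux_woodbury {N P : ℕ} (V : Matrix (Fin N) (Fin P) ℂ) (t s : ℂ) (ht : t ≠ 0) (hs : s ≠ 0)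
    (hu : IsUnit (Vᴴ * V + (s / t) • (1 : Matrix (Fin P) (Fin P) ℂ))) :
    (t • (V * Vᴴ) + s • (1 : Matrix (Fin N) (Fin N) ℂ))⁻¹ =
      s⁻¹ • (1 - V * (Vᴴ * V + (s / t) • (1 : Matrix (Fin P) (Fin P) ℂ))⁻¹ * Vᴴ) := by
  apply Matrix.inv_eq_right_inv
  set M := (Vᴴ * V + (s / t) • (1 : Matrix (Fin P) (Fin P) ℂ))⁻¹ with hM
  have h1 : (Vᴴ * V + (s / t) • (1 : Matrix (Fin P) (Fin P) ℂ)) * M = 1 :=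
    Matrix.mul_nonsing_inv _ ((Matrix.isUnit_iff_isUnit_det _).1 hu)
  have h2 : Vᴴ * V * M = 1 - (s / t) • M := by
    rw [add_mul, Matrix.smul_mul, Matrix.one_mul] at h1
    exact eq_sub_of_add_eq h1
  have h3 : V * Vᴴ * (V * M * Vᴴ) = V * Vᴴ - (s / t) • (V * M * Vᴴ) := by
    calc V * Vᴴ * (V * M * Vᴴ) = V * (Vᴴ * V * M) * Vᴴ := by simp only [Matrix.mul_assoc]
      _ = _ := by rw [h2]; simp [Matrix.mul_sub, Matrix.sub_mul]
  rw [Matrix.mul_smul, add_mul, mul_sub, mul_sub, Matrix.smul_mul, Matrix.smul_mul,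
    Matrix.smul_mul, Matrix.smul_mul, h3]
  simp only [mul_one, one_mul, smul_sub, smul_add, smul_smul]
  have e : s⁻¹ * (t * (s / t)) = 1 := by field_simp
  rw [e, inv_mul_cancel₀ hs]
  simp

open Matrix Filter in
theorem stmt13 (N P : ℕ) (V : Matrix (Fin N) (Fin P) ℂ) (hV : IsUnit (Vᴴ * V))
    (σ : ℝ) (hσ : 0 < σ) (a : Fin N → ℂ) :
    (∀ t : ℝ, 0 ≤ t →
      IsUnit ((t : ℂ) • (V * Vᴴ) + ((σ : ℂ) ^ 2) • (1 : Matrix (Fin N) (Fin N) ℂ))) ∧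
    Tendsto
      (fun t : ℝ => star a ⬝ᵥ
        (((t : ℂ) • (V * Vᴴ) + ((σ : ℂ) ^ 2) • (1 : Matrix (Fin N) (Fin N) ℂ))⁻¹ *ᵥ a))
      atTop
      (nhds (((σ : ℂ) ^ 2)⁻¹ *
        (star a ⬝ᵥ (((1 : Matrix (Fin N) (Fin N) ℂ) - V * (Vᴴ * V)⁻¹ * Vᴴ) *ᵥ a)))) ∧
    star a ⬝ᵥ (((1 : Matrix (Fin N) (Fin N) ℂ) - V * (Vᴴ * V)⁻¹ * Vᴴ) *ᵥ a) =
      ((∑ i : Fin N,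
        ‖((((1 : Matrix (Fin N) (Fin N) ℂ) - V * (Vᴴ * V)⁻¹ * Vᴴ) *ᵥ a) i)‖ ^ 2 : ℝ) : ℂ) := by
  have hs : 0 < σ ^ 2 := by positivity
  have hsc : ((σ : ℂ) ^ 2) = ((σ ^ 2 : ℝ) : ℂ) := by push_cast; rfl
  have hs0 : ((σ : ℂ) ^ 2) ≠ 0 := by rw [hsc]; exact_mod_cast hs.ne'
  refine ⟨fun t ht => ?_, ?_, ?_⟩
  · rw [hsc]; exact aux_unit V t _ ht hs
  · have hlim : Tendsto (fun t : ℝ => Vᴴ * V + ((σ : ℂ) ^ 2 / (t : ℂ)) • (1 : Matrix (Fin P) (Fin P) ℂ))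
        atTop (nhds (Vᴴ * V)) := by
      have h0 : Tendsto (fun t : ℝ => ((σ : ℂ) ^ 2 / (t : ℂ))) atTop (nhds 0) := by
        have := (Complex.continuous_ofReal.tendsto 0).comp
          ((tendsto_const_nhds (x := σ ^ 2)).div_atTop (tendsto_id (α := ℝ) (x := atTop)))
        simpa [Function.comp_def] using this
      simpa using (tendsto_const_nhds (x := Vᴴ * V)).add
        (h0.smul (tendsto_const_nhds (x := (1 : Matrix (Fin P) (Fin P) ℂ))))
    have hinv := (aux_cont _ hV).tendsto.comp hlim
    have hc : Continuous (fun M : Matrix (Fin P) (Fin P) ℂ =>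
        ((σ : ℂ) ^ 2)⁻¹ * (star a ⬝ᵥ (((1 : Matrix (Fin N) (Fin N) ℂ) - V * M * Vᴴ) *ᵥ a))) := by
      fun_prop
    refine ((hc.tendsto _).comp hinv).congr' ?_
    filter_upwards [eventually_gt_atTop 0] with t ht
    have hu := aux_unit Vᴴ 1 (σ ^ 2 / t) zero_le_one (by positivity)
    rw [aux_woodbury V t _ (by exact_mod_cast ht.ne') hs0 (by simpa using hu)]
    simp [Matrix.smul_mulVec, dotProduct_smul]
  · set Q := (1 : Matrix (Fin N) (Fin N) ℂ) - V * (Vᴴ * V)⁻¹ * Vᴴ with hQ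
    have hG : (Vᴴ * V)⁻¹ * (Vᴴ * V) = 1 :=
      Matrix.nonsing_inv_mul _ ((Matrix.isUnit_iff_isUnit_det _).1 hV)
    have hH : Qᴴ = Q := by
      simp [hQ, Matrix.conjTranspose_nonsing_inv, Matrix.mul_assoc]
    have hP : V * (Vᴴ * V)⁻¹ * Vᴴ * (V * (Vᴴ * V)⁻¹ * Vᴴ) = V * (Vᴴ * V)⁻¹ * Vᴴ := by
      calc _ = V * ((Vᴴ * V)⁻¹ * (Vᴴ * V)) * (Vᴴ * V)⁻¹ * Vᴴ := by
            simp only [Matrix.mul_assoc]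
        _ = _ := by rw [hG, Matrix.mul_one]
    have hI : Qᴴ * Q = Q := by
      rw [hH, hQ, sub_mul, mul_sub, mul_sub, hP]; simp
    have h1 : star a ⬝ᵥ (Q *ᵥ a) = star (Q *ᵥ a) ⬝ᵥ (Q *ᵥ a) := by
      conv_lhs => rw [← hI]
      rw [Matrix.star_mulVec, ← Matrix.mulVec_mulVec, Matrix.dotProduct_mulVec]
    rw [h1]
    simp only [dotProduct, Pi.star_apply, RCLike.star_def, Complex.conj_mul']
    push_cast
    rfl
end
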